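/- The nerve functor N : Set↓Π̲_X → presheaves on 𝔾_{(X,Aut(X))}, given by N(G) = Hom(I(−), G) for the interpretation I : 𝔾_{(X,Aut(X))} → Set↓Π̲_X, is full and faithful. -/

import Mathlib

open CategoryTheory Limits Opposite

/-- The symmetric `X`-power functor `Π̲_X : Set ⥤ Set`: `Π̲_X(Y)` is the quotient of
`Y^X` by precomposition with the automorphism group `Aut X`. -/
def PiXF (X : Type) : Type ⥤ Type where
  obj Y := Quot (fun f g : X → Y => ∃ σ : Equiv.Perm X, f = g ∘ σ)
  map {Y Z} h := ↾(Quot.lift (fun f => Quot.mk _ (h ∘ f)) (by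
    rintro f g ⟨σ, rfl⟩
    exact Quot.sound ⟨σ, rfl⟩))
  map_id Y := by
    ext q
    induction q using Quot.ind with
    | _ f => rfl
  map_comp {Y Z W} h k := by
    ext q
    induction q using Quot.ind with
    | _ f => rfl

/-- The category of `Π̲_X`-graphs, the comma category `Set ↓ Π̲_X`. -/
abbrev PiGraph (X : Type) : Type 1 := Comma (𝟭 Type) (PiXF X)

/-- The two objects of the theory `𝔾_{(X, Aut X)}`. -/
inductive PObj (X : Type) : Type
  | V | A

namespace PObj

/-- Hom-sets of the theory `𝔾_{(X, Aut X)}`: `Hom(V,A) = X`, `Hom(A,A) = Aut X`. -/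
def Homs (X : Type) : PObj X → PObj X → Type
  | V, V => PUnit
  | V, A => X
  | A, V => PEmpty
  | A, A => Equiv.Perm X

/-- The theory `𝔾_{(X, Aut X)}`: composition is given by `σ ∘ x = σ(x)` and
`σ ∘ σ' = σ'σ` (the monoid `Aut X` with its diagrammatic multiplication). -/
instance (X : Type) : Category (PObj X) where
  Hom := Homs X
  id o := match o with
    | V => PUnit.unit
    | A => (1 : Equiv.Perm X)
  comp {a b c} f g := match a, b, c, f, g with
    | V, V, V, _, _ => PUnit.unit
    | V, V, A, _, x => x
    | V, A, V, _, e => e.elim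
    | V, A, A, x, σ => show X from (show Equiv.Perm X from σ) (show X from x)
    | A, V, _, e, _ => e.elim
    | A, A, V, _, e => e.elim
    | A, A, A, σ, τ => show Equiv.Perm X from (show Equiv.Perm X from τ) * (show Equiv.Perm X from σ)
  id_comp {a b} f := by
    cases a <;> cases b <;>
      first
        | exact f.elim
        | rfl
        | exact mul_one (show Equiv.Perm X from f)
  comp_id {a b} f := by
    cases a <;> cases b <;>
      first
        | exact f.elim
        | rfl
        | exact one_mul (show Equiv.Perm X from f)
  assoc {a b c d} f g h := by
    cases a <;> cases b <;> cases c <;> cases d <;>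
      first
        | exact f.elim
        | exact g.elim
        | exact h.elim
        | rfl
        | exact (mul_assoc (show Equiv.Perm X from h) (show Equiv.Perm X from g)
            (show Equiv.Perm X from f)).symm

end PObj

/-- The interpretation functor `I : 𝔾_{(X, Aut X)} ⥤ Set ↓ Π̲_X`: `V ↦ (∅, 1, !)`,
`A ↦ (1, X, ⌜q⌝)` where `q` is the class of `id_X` in `Π̲_X(X)`. -/
def InterpPi (X : Type) : PObj X ⥤ PiGraph X where
  obj o := match o with
    | .V => ⟨Empty, PUnit, ↾(fun e => e.elim)⟩
    | .A => ⟨PUnit, X, ↾(fun _ => Quot.mk _ id)⟩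
  map {a b} f := match a, b, f with
    | .V, .V, _ => 𝟙 _
    | .V, .A, x =>
        { left := ↾(fun e => e.elim)
          right := ↾(fun _ => (show X from x))
          w := by ext e; exact e.elim }
    | .A, .V, e => e.elim
    | .A, .A, σ =>
        { left := ↾id
          right := ↾(show Equiv.Perm X from σ)
          w := by
            ext u
            exact Quot.sound (r := fun f g : X → X => ∃ τ : Equiv.Perm X, f = g ∘ τ)
              ⟨(show Equiv.Perm X from σ)⁻¹, by
                funext y
                exact (Equiv.apply_symm_apply (show Equiv.Perm X from σ) y).symm⟩ }
  map_id o := by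
    cases o
    · rfl
    · apply CommaMorphism.ext <;> rfl
  map_comp {a b c} f g := by
    cases a <;> cases b <;> cases c <;>
      first
        | exact f.elim
        | exact g.elim
        | apply CommaMorphism.ext <;> rfl

/-- The nerve `N := Hom(I(−), −) : Set ↓ Π̲_X ⥤ presheaves on 𝔾_{(X, Aut X)}`. -/
noncomputable def nervePi (X : Type) : PiGraph X ⥤ ((PObj X)ᵒᵖ ⥤ Type) :=
  yoneda ⋙ (Functor.whiskeringLeft _ _ Type).obj (InterpPi X).op

namespace NervePiAux

theorem quot_exact {X Y : Type} {f g : X → Y}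
    (h : Quot.mk (fun f g : X → Y => ∃ σ : Equiv.Perm X, f = g ∘ σ) f = Quot.mk _ g) :
    ∃ σ : Equiv.Perm X, f = g ∘ σ := by
  have h' := Quot.eqvGen_exact h
  clear h
  induction h' with
  | rel _ _ h => exact h
  | refl => exact ⟨1, rfl⟩
  | symm x y _ ih =>
    obtain ⟨σ, rfl⟩ := ih
    exact ⟨σ⁻¹, by funext y; simp⟩
  | trans x y z _ _ ih1 ih2 =>
    obtain ⟨σ, rfl⟩ := ih1
    obtain ⟨τ, rfl⟩ := ih2
    exact ⟨τ * σ, rfl⟩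

variable {X : Type} {G H : PiGraph X}

/-- vertex as a morphism -/
def vert (G : PiGraph X) (v : G.right) : (InterpPi X).obj .V ⟶ G where
  left := ↾(fun e : Empty => e.elim)
  right := ↾(fun _ : PUnit => v)
  w := by ext e; exact Empty.elim e

/-- arc with a chosen labelling as a morphism -/
def arr (G : PiGraph X) (e : G.left) (f : X → G.right)
    (h : G.hom e = Quot.mk _ f) : (InterpPi X).obj .A ⟶ G where
  left := ↾(fun _ : PUnit => e)
  right := ↾f
  w := by ext u; exact h

theorem exists_lab (G : PiGraph X) (e : G.left) :
    ∃ f : X → G.right, G.hom e = Quot.mk _ f :=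
  (Quot.exists_rep (G.hom e)).imp fun _ h => h.symm

/-- a component of a transformation of nerves -/
def comp (φ : (nervePi X).obj G ⟶ (nervePi X).obj H) (o : PObj X)
    (a : (InterpPi X).obj o ⟶ G) : (InterpPi X).obj o ⟶ H := φ.app (op o) a

theorem comp_nat (φ : (nervePi X).obj G ⟶ (nervePi X).obj H) {o p : PObj X} (k : o ⟶ p)
    (a : (InterpPi X).obj p ⟶ G) :
    comp φ o ((InterpPi X).map k ≫ a) = (InterpPi X).map k ≫ comp φ p a :=
  ConcreteCategory.congr_hom (φ.naturality k.op) a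

/-- induced map on vertices -/
def vmap (φ : (nervePi X).obj G ⟶ (nervePi X).obj H) (v : G.right) : H.right :=
  (comp φ .V (vert G v)).right PUnit.unit

theorem vmap_arr (φ : (nervePi X).obj G ⟶ (nervePi X).obj H)
    (a : (InterpPi X).obj .A ⟶ G) (x : X) :
    (comp φ .A a).right x = vmap φ (a.right x) := by
  have h := comp_nat φ (show PObj.V ⟶ PObj.A from (x : X)) a
  have e : (InterpPi X).map (show PObj.V ⟶ PObj.A from (x : X)) ≫ a = vert G (a.right x) := by
    apply CommaMorphism.ext
    · ext e; exact Empty.elim e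
    · rfl
  rw [e] at h
  have := congrArg (fun m : (InterpPi X).obj .V ⟶ H => m.right PUnit.unit) h
  exact this.symm

theorem hom_arr (a : (InterpPi X).obj .A ⟶ G) :
    G.hom (a.left PUnit.unit) = Quot.mk _ (a.right : X → G.right) :=
  ConcreteCategory.congr_hom a.w PUnit.unit

theorem left_eq (φ : (nervePi X).obj G ⟶ (nervePi X).obj H)
    (a b : (InterpPi X).obj .A ⟶ G) (h : a.left PUnit.unit = b.left PUnit.unit) :
    (comp φ .A a).left PUnit.unit = (comp φ .A b).left PUnit.unit := by
  have h1 := hom_arr a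
  rw [h, hom_arr b] at h1
  obtain ⟨σ, hσ⟩ := quot_exact h1
  have e : (InterpPi X).map (show PObj.A ⟶ PObj.A from (σ : Equiv.Perm X)) ≫ a = b := by
    apply CommaMorphism.ext
    · ext u; exact h
    · ext x; exact (congrFun hσ x).symm
  have h2 := comp_nat φ (show PObj.A ⟶ PObj.A from (σ : Equiv.Perm X)) a
  rw [e] at h2
  rw [h2]; rfl

/-- the preimage -/
noncomputable def pre (φ : (nervePi X).obj G ⟶ (nervePi X).obj H) : G ⟶ H where
  left := ↾(fun e : G.left => (comp φ .A
    (arr G e (exists_lab G e).choose (exists_lab G e).choose_spec)).left PUnit.unit)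
  right := ↾(vmap φ)
  w := by
    ext e
    have h1 := hom_arr (comp φ .A (arr G e (exists_lab G e).choose (exists_lab G e).choose_spec))
    refine Eq.trans h1 ?_
    have h2 : (PiXF X).map (↾(vmap φ)) (G.hom e) = Quot.mk _ (vmap φ ∘ (exists_lab G e).choose) :=
      congrArg ((PiXF X).map (↾(vmap φ))) (exists_lab G e).choose_spec
    refine Eq.trans ?_ h2.symm
    refine congrArg (Quot.mk _) ?_
    funext x
    exact vmap_arr φ _ x

end NervePiAux

open NervePiAux

/-- The nerve functor `N = Hom(I(−), −) : Set ↓ Π̲_X ⥤ presheaves on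
`𝔾_{(X, Aut X)}` is full and faithful. -/
theorem statement16 (X : Type) : (nervePi X).Full ∧ (nervePi X).Faithful := by
  refine ⟨⟨fun {G H} φ => ⟨pre φ, ?_⟩⟩, ⟨fun {G H} f g h => ?_⟩⟩
  · ext ⟨o⟩ a
    change (InterpPi X).obj o ⟶ G at a
    change a ≫ pre φ = comp φ o a
    cases o with
    | V =>
      have e : a = vert G (a.right PUnit.unit) := by
        apply CommaMorphism.ext
        · ext e; exact Empty.elim e
        · rfl
      apply CommaMorphism.ext
      · ext e; exact Empty.elim e
      · ext u
        change vmap φ (a.right PUnit.unit) = (comp φ .V a).right PUnit.unit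
        conv_rhs => rw [e]
        rfl
    | A =>
      apply CommaMorphism.ext
      · ext u
        exact left_eq φ _ a rfl
      · ext x
        exact (vmap_arr φ a x).symm
  · have key : ∀ (o : PObj X) (a : (InterpPi X).obj o ⟶ G), a ≫ f = a ≫ g := fun o a =>
      ConcreteCategory.congr_hom (NatTrans.congr_app h (op o)) a
    apply CommaMorphism.ext
    · ext e
      obtain ⟨l, hl⟩ := exists_lab G e
      exact congrArg (fun m : (InterpPi X).obj .A ⟶ H => m.left PUnit.unit) (key .A (arr G e l hl))
    · ext v
      exact congrArg (fun m : (InterpPi X).obj .V ⟶ H => m.right PUnit.unit) (key .V (vert G v))
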